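/- arXiv:1605.02410 — 2 statements merged into one kernel-verified Lean document; each statement's English description precedes it below -/
import Mathlib

section
/- Let m ≥ 2 be an even integer. For every real β with 0 < β < 1, the equation ((1+t)^(m−1) + (1−t)^(m−1)) / ((1+t)^m + (1−t)^m) = 1 − β has exactly one root t in the interval (0, ∞). -/
lemma Odd.one_add_pow_add_one_sub_pow_pos {n : ℕ} (hn : Odd n) (t : ℝ) :
    0 < (1 + t) ^ n + (1 - t) ^ n := by
  have h : (-(1 + t)) ^ n < (1 - t) ^ n := hn.strictMono_pow (by linarith)
  rw [hn.neg_pow] at h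
  linarith

lemma Odd.strictMonoOn_one_add_pow_sub_div_add {n : ℕ} (hn : Odd n) :
    StrictMonoOn (fun t : ℝ => ((1 + t) ^ n - (1 - t) ^ n) / ((1 + t) ^ n + (1 - t) ^ n))
      (Set.Ici 0) := by
  intro s hs t ht hst
  have h : ((1 + s) * (1 - t)) ^ n < ((1 + t) * (1 - s)) ^ n := hn.strictMono_pow (by linarith)
  rw [mul_pow, mul_pow] at h
  refine (div_lt_div_iff₀ (hn.one_add_pow_add_one_sub_pow_pos s)
    (hn.one_add_pow_add_one_sub_pow_pos t)).2 ?_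
  linarith

lemma Odd.strictMonoOn_mul_one_add_pow_sub_div_add {n : ℕ} (hn : Odd n) :
    StrictMonoOn
      (fun t : ℝ => t * (((1 + t) ^ n - (1 - t) ^ n) / ((1 + t) ^ n + (1 - t) ^ n)))
      (Set.Ici 0) := by
  intro s hs t ht hst
  have hq := hn.strictMonoOn_one_add_pow_sub_div_add
  have hpos := hq (Set.mem_Ici.2 le_rfl) ht (lt_of_le_of_lt hs hst)
  simp only [add_zero, sub_zero, sub_self, zero_div] at hpos
  exact (mul_le_mul_of_nonneg_left (hq hs ht hst).le hs).trans_lt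
    (mul_lt_mul_of_pos_right hst hpos)

lemma Odd.exists_pos_mul_one_add_pow_sub_div_add_eq {n : ℕ} (hn : Odd n) {c : ℝ} (hc : 0 < c) :
    ∃ t : ℝ, 0 < t ∧
      t * (((1 + t) ^ n - (1 - t) ^ n) / ((1 + t) ^ n + (1 - t) ^ n)) = c := by
  have hcont : ContinuousOn
      (fun t : ℝ => t * (((1 + t) ^ n - (1 - t) ^ n) / ((1 + t) ^ n + (1 - t) ^ n)))
      (Set.Icc 0 (1 + c)) :=
    continuousOn_id.mul (ContinuousOn.div (by fun_prop) (by fun_prop)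
      fun t _ => (hn.one_add_pow_add_one_sub_pow_pos t).ne')
  have hlarge : 1 ≤ ((1 + (1 + c)) ^ n - (1 - (1 + c)) ^ n) /
      ((1 + (1 + c)) ^ n + (1 - (1 + c)) ^ n) := by
    have hneg : (1 - (1 + c)) ^ n ≤ 0 := hn.pow_nonpos (by linarith)
    rw [one_le_div (hn.one_add_pow_add_one_sub_pow_pos _)]
    linarith
  obtain ⟨t, ht, hval⟩ := intermediate_value_Icc (by positivity) hcont
    (show c ∈ Set.Icc _ _ from ⟨by simpa using hc.le, by nlinarith⟩)
  refine ⟨t, ht.1.lt_of_ne ?_, hval⟩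
  rintro rfl
  simp only [zero_mul] at hval
  exact hc.ne hval

lemma Odd.one_add_pow_add_div_succ_eq_iff {n : ℕ} (hn : Odd n) {t β : ℝ} (ht : 0 ≤ t)
    (hβ : β < 1) :
    ((1 + t) ^ n + (1 - t) ^ n) / ((1 + t) ^ (n + 1) + (1 - t) ^ (n + 1)) = 1 - β ↔
      t * (((1 + t) ^ n - (1 - t) ^ n) / ((1 + t) ^ n + (1 - t) ^ n)) = β / (1 - β) := by
  have hpos := hn.one_add_pow_add_one_sub_pow_pos t
  have hden : 0 < (1 + t) ^ (n + 1) + (1 - t) ^ (n + 1) :=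
    add_pos_of_pos_of_nonneg (by positivity) (hn.add_one.pow_nonneg _)
  have hβ' : 1 - β ≠ 0 := by linarith
  rw [div_eq_iff hden.ne', ← mul_div_assoc, div_eq_div_iff hpos.ne' hβ', pow_succ, pow_succ]
  constructor <;> intro h <;> linarith

/-- For even `m ≥ 2` and `β ∈ (0,1)`, the equation
`((1+t)^(m-1) + (1-t)^(m-1)) / ((1+t)^m + (1-t)^m) = 1 - β`
has exactly one root `t ∈ (0, ∞)`. -/
theorem stmt_4 (m : ℕ) (hm : 2 ≤ m) (hme : Even m) (β : ℝ) (hβ0 : 0 < β) (hβ1 : β < 1) :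
    ∃! t : ℝ, 0 < t ∧
      ((1 + t) ^ (m - 1) + (1 - t) ^ (m - 1)) / ((1 + t) ^ m + (1 - t) ^ m) = 1 - β := by
  obtain ⟨n, rfl⟩ : ∃ n, m = n + 1 := ⟨m - 1, by omega⟩
  have hn : Odd n := by rwa [Nat.even_add_one, Nat.not_even_iff_odd] at hme
  rw [Nat.add_sub_cancel]
  obtain ⟨t, ht, hval⟩ :=
    hn.exists_pos_mul_one_add_pow_sub_div_add_eq (div_pos hβ0 (sub_pos.2 hβ1))
  refine ⟨t, ⟨ht, (hn.one_add_pow_add_div_succ_eq_iff ht.le hβ1).2 hval⟩, ?_⟩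
  rintro s ⟨hs, hs_eq⟩
  exact hn.strictMonoOn_mul_one_add_pow_sub_div_add.injOn hs.le ht.le
    (((hn.one_add_pow_add_div_succ_eq_iff hs.le hβ1).1 hs_eq).trans hval.symm)
end

section
/- Let c ∈ 𝔽₂ⁿ be a vector of Hamming weight d, and let 1 ≤ s ≤ n. Then there exists an index i ∈ {0, 1, …, n−1} such that the Hamming weight of c restricted to the cyclic window I(i,s) = {i, i+1, …, i+s−1} (indices modulo n) is exactly ⌊d·s/n⌋. -/
/-- The number of nonzero entries of `c` in the cyclic window of length `s` starting at `a`. -/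
def windowWeight {n : ℕ} (c : ZMod n → ZMod 2) (s : ℕ) (a : ZMod n) : ℕ :=
  ((Finset.range s).filter (fun j : ℕ => c (a + (j : ZMod n)) ≠ 0)).card

theorem windowWeight_eq_sum {n : ℕ} (c : ZMod n → ZMod 2) (s : ℕ) (a : ZMod n) :
    windowWeight c s a = ∑ j ∈ Finset.range s, if c (a + (j : ZMod n)) ≠ 0 then 1 else 0 :=
  Finset.card_filter _ _

theorem windowWeight_add_one_le {n : ℕ} (c : ZMod n → ZMod 2) (s : ℕ) (a : ZMod n) :
    windowWeight c s (a + 1) ≤ windowWeight c s a + 1 := by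
  have h := Finset.sum_range_succ (fun j : ℕ => if c (a + (j : ZMod n)) ≠ 0 then 1 else 0) s
  rw [Finset.sum_range_succ', ← windowWeight_eq_sum] at h
  have h' : windowWeight c s (a + 1)
      = ∑ j ∈ Finset.range s, if c (a + ((j + 1 : ℕ) : ZMod n)) ≠ 0 then 1 else 0 := by
    rw [windowWeight_eq_sum]
    refine Finset.sum_congr rfl fun j _ => ?_
    rw [Nat.cast_add, Nat.cast_one, add_assoc, add_comm (1 : ZMod n)]
  rw [← h'] at h
  split_ifs at h <;> omega

theorem sum_windowWeight {n : ℕ} [NeZero n] (c : ZMod n → ZMod 2) (s : ℕ) :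
    ∑ a, windowWeight c s a = hammingNorm c * s := by
  simp_rw [windowWeight_eq_sum]
  rw [Finset.sum_comm, mul_comm]
  have h (j : ℕ) : (∑ a : ZMod n, if c (a + (j : ZMod n)) ≠ 0 then 1 else 0)
      = hammingNorm c := by
    rw [hammingNorm, Finset.card_filter]
    exact Equiv.sum_comp (Equiv.addRight (j : ZMod n)) (fun a => if c a ≠ 0 then 1 else 0)
  simp_rw [h]
  simp

theorem exists_windowWeight_eq {n : ℕ} [NeZero n] (c : ZMod n → ZMod 2) (s : ℕ) :
    ∃ a, windowWeight c s a = hammingNorm c * s / n := by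
  have hn : 0 < n := Nat.pos_of_ne_zero (NeZero.ne n)
  set q := hammingNorm c * s / n with hq
  by_contra! hne
  obtain ⟨a, ha⟩ : ∃ a, windowWeight c s a < q := by
    by_contra! h
    have hsum : ∑ _a : ZMod n, (q + 1) ≤ ∑ a, windowWeight c s a :=
      Finset.sum_le_sum fun a _ => lt_of_le_of_ne (h a) (hne a).symm
    rw [sum_windowWeight, Finset.sum_const, Finset.card_univ, ZMod.card, smul_eq_mul] at hsum
    exact absurd hsum (Nat.lt_mul_div_succ _ hn).not_ge
  have hall (k : ℕ) : windowWeight c s (a + k) < q := by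
    induction k with
    | zero => simpa using ha
    | succ k ih =>
      have h := windowWeight_add_one_le c s (a + k)
      rw [Nat.cast_add, Nat.cast_one, ← add_assoc]
      exact lt_of_le_of_ne (h.trans ih) (hne _)
  have hsum : ∑ b, windowWeight c s b < ∑ _b : ZMod n, q := by
    refine Finset.sum_lt_sum_of_nonempty Finset.univ_nonempty fun b _ => ?_
    simpa using hall (b - a).val
  rw [sum_windowWeight, Finset.sum_const, Finset.card_univ, ZMod.card, smul_eq_mul] at hsum
  exact absurd hsum (Nat.mul_div_le _ n).not_gt

/-- For a vector `c ∈ 𝔽₂ⁿ` of Hamming weight `d` there is a cyclic window `I(i,s)` on which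
`c` has Hamming weight exactly `⌊d·s/n⌋`. -/
theorem stmt_11 (n s d : ℕ) [NeZero n] (hs1 : 1 ≤ s) (hsn : s ≤ n)
    (c : ZMod n → ZMod 2) (hd : hammingNorm c = d) :
    ∃ i : ℕ, i < n ∧
      ((Finset.range s).filter (fun j : ℕ => c ((i : ZMod n) + (j : ZMod n)) ≠ 0)).card
        = d * s / n := by
  obtain ⟨a, ha⟩ := exists_windowWeight_eq c s
  refine ⟨a.val, ZMod.val_lt a, ?_⟩
  rw [ZMod.natCast_zmod_val, ← hd]
  exact ha
end
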